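/- arXiv:1002.4187 — 2 statements merged into one kernel-verified Lean document; each statement's English description precedes it below -/
import Mathlib

section
/- For any Young diagram Y, twice the sum of the contents of the boxes of Y divided by H_Y equals the sum over removable horizontal dominoes hd of 1/H_{Y - hd} minus the sum over removable vertical dominoes vd of 1/H_{Y - vd}. -/
/-- The hook length of the box `u` in the cell set `c`. -/
def hookLen (c : Finset (ℕ × ℕ)) (u : ℕ × ℕ) : ℕ :=
  (c.filter fun v => v.1 = u.1 ∧ u.2 ≤ v.2).card +
  (c.filter fun v => v.2 = u.2 ∧ u.1 < v.1).card

/-- The product of all hook lengths of a cell set. -/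
def hookProd (c : Finset (ℕ × ℕ)) : ℕ := ∏ u ∈ c, hookLen c u

section

open Finset

/-- The ordered Vandermonde product `∏_{i < k < n} (w i - w k)`. -/
def orderedVandermonde (n : ℕ) (w : ℕ → ℚ) : ℚ :=
  ∏ i ∈ range n, ∏ k ∈ range n, if i < k then w i - w k else 1

/-- The Frobenius quotient of a sequence `m`: its ordered Vandermonde product divided by the
product of the factorials of its first `n` terms. -/
def frobeniusQuotient (n : ℕ) (m : ℕ → ℕ) : ℚ :=
  orderedVandermonde n (fun i => (m i : ℚ)) / ∏ i ∈ range n, ((m i).factorial : ℚ)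

theorem orderedVandermonde_eq_det (n : ℕ) (w : ℕ → ℚ) :
    orderedVandermonde n w = (Matrix.vandermonde fun i : Fin n => -w i).det := by
  rw [Matrix.det_vandermonde, orderedVandermonde, prod_range]
  refine prod_congr rfl fun i _ => ?_
  rw [prod_range, ← prod_filter_mul_prod_filter_not univ (fun k : Fin n => i < k)]
  rw [prod_congr rfl (g := fun k : Fin n => -w k - -w i), mul_comm, prod_eq_one, one_mul]
  · congr 1
    ext k
    simp
  · intro k hk
    have : ¬ (i : ℕ) < k := by simpa using hk
    simp [this]
  · intro k hk
    have : (i : ℕ) < k := by simpa using hk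
    simp only [this, if_true]
    ring

theorem orderedVandermonde_comp_swap {n i k : ℕ} (hi : i < n) (hk : k < n) (hik : i ≠ k)
    (w : ℕ → ℚ) :
    orderedVandermonde n (w ∘ Equiv.swap i k) = -orderedVandermonde n w := by
  rw [orderedVandermonde_eq_det, orderedVandermonde_eq_det]
  have hne : (⟨i, hi⟩ : Fin n) ≠ ⟨k, hk⟩ := by simpa using hik
  have h := Matrix.det_permute (Equiv.swap (⟨i, hi⟩ : Fin n) ⟨k, hk⟩)
    (Matrix.vandermonde fun a : Fin n => -w a)
  rw [Equiv.Perm.sign_swap hne] at h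
  rw [show -(Matrix.vandermonde fun a : Fin n => -w a).det
    = ((-1 : ℤˣ) : ℤ) * (Matrix.vandermonde fun a : Fin n => -w a).det by simp, ← h]
  congr 1
  ext a b
  have : Equiv.swap i k (a : ℕ) = (Equiv.swap (⟨i, hi⟩ : Fin n) ⟨k, hk⟩ a : Fin n) := by
    simp only [Equiv.swap_apply_def, Fin.ext_iff]
    split_ifs <;> rfl
  simp [Matrix.vandermonde_apply, this]

theorem frobeniusQuotient_comp_swap {n i k : ℕ} (hi : i < n) (hk : k < n) (hik : i ≠ k)
    (m : ℕ → ℕ) :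
    frobeniusQuotient n (m ∘ Equiv.swap i k) = -frobeniusQuotient n m := by
  have hV := orderedVandermonde_comp_swap hi hk hik (fun a => (m a : ℚ))
  have hP : ∏ a ∈ range n, (((m ∘ Equiv.swap i k) a).factorial : ℚ)
      = ∏ a ∈ range n, ((m a).factorial : ℚ) := by
    refine Equiv.Perm.prod_comp (Equiv.swap i k) (range n) (fun a => ((m a).factorial : ℚ)) ?_
    intro a ha
    by_contra hn
    have h1 : a ≠ i := by rintro rfl; simp [hi] at hn
    have h2 : a ≠ k := by rintro rfl; simp [hk] at hn
    exact ha (Equiv.swap_apply_of_ne_of_ne h1 h2)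
  unfold frobeniusQuotient
  rw [hP, ← neg_div, ← hV]
  rfl

theorem orderedVandermonde_eq_mul {n i : ℕ} (hi : i < n) (w : ℕ → ℚ) :
    orderedVandermonde n w = ((∏ k ∈ (range n).erase i, if i < k then 1 else -1) *
      ∏ k ∈ (range n).erase i, (w i - w k)) *
      ∏ a ∈ (range n).erase i, ∏ k ∈ (range n).erase i, if a < k then w a - w k else 1 := by
  have hi' : i ∈ range n := mem_range.2 hi
  have step : ∀ a : ℕ, (∏ k ∈ range n, if a < k then w a - w k else 1) =
      (if a < i then w a - w i else 1) *
        ∏ k ∈ (range n).erase i, if a < k then w a - w k else 1 := fun a =>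
    (mul_prod_erase (range n) (fun k => if a < k then w a - w k else 1) hi').symm
  unfold orderedVandermonde
  rw [← mul_prod_erase (range n) (fun a => ∏ k ∈ range n, if a < k then w a - w k else 1) hi',
    step i]
  simp_rw [step]
  rw [prod_mul_distrib, if_neg (lt_irrefl i), one_mul, ← mul_assoc]
  congr 1
  rw [← prod_mul_distrib, ← prod_mul_distrib]
  refine prod_congr rfl fun k hk => ?_
  have : k ≠ i := (mem_erase.1 hk).1
  rcases lt_or_gt_of_ne this with h | h
  · simp [h, h.not_gt]
  · simp [h, h.not_gt]

theorem orderedVandermonde_update_mul {n i : ℕ} (hi : i < n) (w : ℕ → ℚ) (x : ℚ) :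
    orderedVandermonde n (Function.update w i x) * ∏ k ∈ (range n).erase i, (w i - w k) =
      orderedVandermonde n w * ∏ k ∈ (range n).erase i, (x - w k) := by
  rw [orderedVandermonde_eq_mul hi w, orderedVandermonde_eq_mul hi (Function.update w i x)]
  have h : ∀ k ∈ (range n).erase i, Function.update w i x k = w k := fun k hk =>
    Function.update_of_ne (mem_erase.1 hk).1 _ _
  have h1 : ∏ k ∈ (range n).erase i, (Function.update w i x i - Function.update w i x k) =
      ∏ k ∈ (range n).erase i, (x - w k) :=
    prod_congr rfl fun k hk => by rw [h k hk, Function.update_self]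
  have h2 : (∏ a ∈ (range n).erase i, ∏ k ∈ (range n).erase i,
      if a < k then Function.update w i x a - Function.update w i x k else 1) =
      ∏ a ∈ (range n).erase i, ∏ k ∈ (range n).erase i, if a < k then w a - w k else 1 :=
    prod_congr rfl fun a ha => prod_congr rfl fun k hk => by rw [h k hk, h a ha]
  rw [h1, h2]
  ring

theorem frobeniusQuotient_update_sub_two {n i : ℕ} (hi : i < n) {m : ℕ → ℕ}
    (hm : Set.InjOn m (range n)) (h2 : 2 ≤ m i) :
    frobeniusQuotient n (Function.update m i (m i - 2)) =
      frobeniusQuotient n m * ((m i : ℚ) * (m i - 1) *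
        ∏ k ∈ (range n).erase i, ((m i : ℚ) - m k - 2) / (m i - m k)) := by
  have hi' : i ∈ range n := mem_range.2 hi
  have hV := orderedVandermonde_update_mul hi (fun a => (m a : ℚ)) ((m i : ℚ) - 2)
  have hne : ∏ k ∈ (range n).erase i, ((m i : ℚ) - m k) ≠ 0 := by
    refine prod_ne_zero_iff.2 fun k hk => sub_ne_zero.2 fun h => ?_
    have hk' := mem_erase.1 hk
    exact hk'.1 (hm (mem_coe.2 hk'.2) (mem_coe.2 hi') (by exact_mod_cast h.symm))
  have hw : (fun a => ((Function.update m i (m i - 2) a : ℕ) : ℚ)) =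
      Function.update (fun a => (m a : ℚ)) i ((m i : ℚ) - 2) := by
    funext a
    by_cases ha : a = i
    · subst ha
      simp [Nat.cast_sub h2]
    · simp [ha]
  have hF : (∏ a ∈ range n, ((Function.update m i (m i - 2) a).factorial : ℚ)) *
      ((m i : ℚ) * (m i - 1)) = ∏ a ∈ range n, ((m a).factorial : ℚ) := by
    rw [← mul_prod_erase (range n) (fun a => ((m a).factorial : ℚ)) hi',
      ← mul_prod_erase (range n)
        (fun a => ((Function.update m i (m i - 2) a).factorial : ℚ)) hi',
      prod_congr rfl (g := fun a => ((m a).factorial : ℚ)) fun a ha => by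
        rw [Function.update_of_ne (mem_erase.1 ha).1], Function.update_self]
    obtain ⟨t, ht⟩ := Nat.exists_eq_add_of_le' h2
    rw [ht, Nat.add_sub_cancel, Nat.factorial_succ (t + 1), Nat.factorial_succ t]
    push_cast
    ring
  have hF0 : (∏ a ∈ range n, ((Function.update m i (m i - 2) a).factorial : ℚ)) ≠ 0 :=
    prod_ne_zero_iff.2 fun a _ => by exact_mod_cast Nat.factorial_ne_zero _
  have hF1 : (∏ a ∈ range n, ((m a).factorial : ℚ)) ≠ 0 :=
    prod_ne_zero_iff.2 fun a _ => by exact_mod_cast Nat.factorial_ne_zero _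
  have hQ : ∏ k ∈ (range n).erase i, ((m i : ℚ) - m k - 2) =
      ∏ k ∈ (range n).erase i, ((m i : ℚ) - 2 - m k) :=
    prod_congr rfl fun k _ => by ring
  unfold frobeniusQuotient
  rw [prod_div_distrib, hw, hQ]
  rw [div_mul_eq_mul_div, mul_comm (_ * _) (_ / _), div_mul_eq_mul_div, mul_div_assoc',
    div_div, div_eq_div_iff hF0 (mul_ne_zero hne hF1)]
  rw [← hF]
  linear_combination (∏ a ∈ range n, ((Function.update m i (m i - 2) a).factorial : ℚ)) *
    ((m i : ℚ) * (m i - 1)) * hV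

section PartialFractions

variable {ι : Type*} [DecidableEq ι]

/-- `g`-weighted sum of the residues of `∏_{j ∈ s} (x - v j - 2) / (x - v j)`. -/
def residueSum (s : Finset ι) (v : ι → ℚ) (g : ℚ → ℚ) : ℚ :=
  ∑ i ∈ s, -2 * g (v i) * ∏ j ∈ s.erase i, (v i - v j - 2) / (v i - v j)

theorem residueSum_insert_of_prod_eq {s : Finset ι} {a : ι} {v : ι → ℚ} (ha : a ∉ s) (g : ℚ → ℚ)
    (hv : Set.InjOn v (insert a s : Finset ι))
    (hpf : ∏ j ∈ s, (v a - v j - 2) / (v a - v j) =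
      1 + residueSum s v (fun t => 1 / (v a - t))) :
    residueSum (insert a s) v g = residueSum s v g -
      2 * residueSum s v (fun t => (g t - g (v a)) / (t - v a)) - 2 * g (v a) := by
  have hne : ∀ i ∈ s, v i - v a ≠ 0 := fun i hi => sub_ne_zero.2 fun h =>
    ha (hv (by simp [hi]) (by simp) h ▸ hi)
  have hne' : ∀ i ∈ s, v a - v i ≠ 0 := fun i hi => by
    rw [← neg_sub]; exact neg_ne_zero.2 (hne i hi)
  unfold residueSum at hpf ⊢
  rw [sum_insert ha, erase_insert ha, hpf, mul_add, mul_sum, mul_sum]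
  have : ∀ i ∈ s, -2 * g (v i) * ∏ j ∈ (insert a s).erase i, (v i - v j - 2) / (v i - v j) =
      -2 * g (v i) * ((v i - v a - 2) / (v i - v a)) *
        ∏ j ∈ s.erase i, (v i - v j - 2) / (v i - v j) := fun i hi => by
    have hai : a ≠ i := by rintro rfl; exact ha hi
    rw [erase_insert_of_ne hai, prod_insert (fun h => ha (mem_of_mem_erase h))]
    ring
  rw [sum_congr rfl this, add_assoc, ← sum_add_distrib, ← sum_sub_distrib, mul_one,
    add_comm, sub_eq_add_neg _ (2 * g (v a)), neg_mul 2 (g (v a))]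
  congr 1
  refine sum_congr rfl fun i hi => ?_
  have h1 := hne i hi
  have h2 := hne' i hi
  generalize ∏ j ∈ s.erase i, (v i - v j - 2) / (v i - v j) = p
  simp only
  field_simp
  ring

theorem prod_eq_one_add_residueSum {s : Finset ι} {v : ι → ℚ} (hv : Set.InjOn v s) {x : ℚ}
    (hx : ∀ i ∈ s, x ≠ v i) :
    ∏ j ∈ s, (x - v j - 2) / (x - v j) = 1 + residueSum s v (fun t => 1 / (x - t)) := by
  induction s using Finset.induction_on generalizing x with
  | empty => simp [residueSum]
  | insert a s ha ih =>
    have hvs : Set.InjOn v s := hv.mono (by simp)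
    have hav : ∀ i ∈ s, v a ≠ v i := fun i hi h => ha (hv (by simp) (by simp [hi]) h ▸ hi)
    have hxa : x - v a ≠ 0 := sub_ne_zero.2 (hx a (by simp))
    have hxs := ih hvs (x := x) fun i hi => hx i (by simp [hi])
    rw [residueSum_insert_of_prod_eq ha _ hv (ih hvs hav), prod_insert ha, hxs]
    have : residueSum s v (fun t => (1 / (x - t) - 1 / (x - v a)) / (t - v a)) =
        1 / (x - v a) * residueSum s v (fun t => 1 / (x - t)) := by
      unfold residueSum
      rw [mul_sum]
      refine sum_congr rfl fun i hi => ?_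
      have h1 : x - v i ≠ 0 := sub_ne_zero.2 (hx i (by simp [hi]))
      have h2 : v i - v a ≠ 0 := sub_ne_zero.2 (hav i hi).symm
      have h3 : (1 / (x - v i) - 1 / (x - v a)) / (v i - v a) =
          1 / (x - v a) * (1 / (x - v i)) := by
        field_simp
        ring
      simp only [h3]
      ring
    rw [this]
    generalize residueSum s v (fun t => 1 / (x - t)) = R
    field_simp
    ring

theorem residueSum_insert {s : Finset ι} {a : ι} {v : ι → ℚ} (ha : a ∉ s) (g : ℚ → ℚ)
    (hv : Set.InjOn v (insert a s : Finset ι)) :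
    residueSum (insert a s) v g = residueSum s v g -
      2 * residueSum s v (fun t => (g t - g (v a)) / (t - v a)) - 2 * g (v a) :=
  residueSum_insert_of_prod_eq ha g hv <| prod_eq_one_add_residueSum (hv.mono (by simp)) fun _ hi h =>
    ha (hv (by simp) (by simp [hi]) h ▸ hi)

theorem residueSum_congr {s : Finset ι} {v : ι → ℚ} {f g : ℚ → ℚ}
    (h : ∀ i ∈ s, f (v i) = g (v i)) : residueSum s v f = residueSum s v g :=
  sum_congr rfl fun i hi => by rw [h i hi]

theorem residueSum_one {s : Finset ι} {v : ι → ℚ} (hv : Set.InjOn v s) :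
    residueSum s v (fun _ => 1) = -2 * #s := by
  induction s using Finset.induction_on with
  | empty => simp [residueSum]
  | insert a s ha ih =>
    rw [residueSum_insert ha _ hv, ih (hv.mono (by simp)), card_insert_of_notMem ha,
      residueSum_congr (g := fun _ => 0) fun i _ => by simp]
    simp [residueSum]
    ring

theorem residueSum_id {s : Finset ι} {v : ι → ℚ} (hv : Set.InjOn v s) :
    residueSum s v (fun t => t) = -2 * ∑ i ∈ s, v i + 2 * #s * (#s - 1) := by
  induction s using Finset.induction_on with
  | empty => simp [residueSum]
  | insert a s ha ih =>
    have hvs : Set.InjOn v s := hv.mono (by simp)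
    have hav : ∀ i ∈ s, v i - v a ≠ 0 := fun i hi => sub_ne_zero.2 fun h =>
      ha (hv (by simp [hi]) (by simp) h ▸ hi)
    rw [residueSum_insert ha _ hv, ih hvs, card_insert_of_notMem ha, sum_insert ha,
      residueSum_congr (f := fun t => (t - v a) / (t - v a)) (g := fun _ => 1)
        fun i hi => div_self (hav i hi), residueSum_one hvs]
    push_cast
    ring

theorem residueSum_mul_sub_one {s : Finset ι} {v : ι → ℚ} (hv : Set.InjOn v s) :
    residueSum s v (fun t => t * (t - 1)) =
      -2 * ∑ i ∈ s, v i * (v i - 1) + 4 * (#s - 1) * ∑ i ∈ s, v i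
        - 4 * ∑ k ∈ range #s, (k : ℚ) ^ 2 := by
  induction s using Finset.induction_on with
  | empty => simp [residueSum]
  | insert a s ha ih =>
    have hvs : Set.InjOn v s := hv.mono (by simp)
    have hav : ∀ i ∈ s, v i - v a ≠ 0 := fun i hi => sub_ne_zero.2 fun h =>
      ha (hv (by simp [hi]) (by simp) h ▸ hi)
    have hlin : residueSum s v (fun t => t + (v a - 1)) =
        residueSum s v (fun t => t) + (v a - 1) * residueSum s v (fun _ => 1) := by
      unfold residueSum
      rw [mul_sum, ← sum_add_distrib]
      exact sum_congr rfl fun i _ => by ring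
    rw [residueSum_insert ha _ hv, ih hvs, card_insert_of_notMem ha, sum_insert ha,
      sum_insert ha, sum_range_succ,
      residueSum_congr (f := fun t => (t * (t - 1) - v a * (v a - 1)) / (t - v a))
        (g := fun t => t + (v a - 1)) fun i hi => by
          rw [div_eq_iff (hav i hi)]; ring,
      hlin, residueSum_one hvs, residueSum_id hvs]
    push_cast
    ring

end PartialFractions

namespace YoungDiagram

/-- The beta numbers (first-column hook lengths) of `Y` viewed as a diagram with `n` rows. -/
def betaNumber (Y : YoungDiagram) (n i : ℕ) : ℕ := Y.rowLen i + (n - 1 - i)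

theorem rowLen_eq_of_forall {Y : YoungDiagram} {i m : ℕ} (h : ∀ j, (i, j) ∈ Y ↔ j < m) :
    Y.rowLen i = m := by
  have h' : ∀ j, j < Y.rowLen i ↔ j < m := fun j => mem_iff_lt_rowLen.symm.trans (h j)
  have h1 := h' m
  have h2 := h' (Y.rowLen i)
  omega

theorem rowLen_eq_zero {Y : YoungDiagram} {n i : ℕ} (hn : Y.colLen 0 ≤ n) (hi : n ≤ i) :
    Y.rowLen i = 0 := by
  by_contra h
  have := mem_iff_lt_colLen.1 (mem_iff_lt_rowLen.2 (Nat.pos_of_ne_zero h) : (i, 0) ∈ Y)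
  omega

theorem colLen_zero_le {Y : YoungDiagram} {n : ℕ} (h : Y.rowLen n = 0) : Y.colLen 0 ≤ n := by
  by_contra! hn
  have := mem_iff_lt_rowLen.1 (mem_iff_lt_colLen.2 hn)
  omega

theorem betaNumber_lt {Y : YoungDiagram} {n i k : ℕ} (hik : i < k) (hk : k < n) :
    Y.betaNumber n k < Y.betaNumber n i := by
  have := Y.rowLen_anti i k hik.le
  unfold betaNumber
  omega

theorem injOn_betaNumber (Y : YoungDiagram) (n : ℕ) : Set.InjOn (Y.betaNumber n) (range n) := by
  intro i hi k hk h
  simp only [coe_range, Set.mem_Iio] at hi hk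
  rcases lt_trichotomy i k with hlt | rfl | hlt
  · exact absurd h (betaNumber_lt hlt hk).ne'
  · rfl
  · exact absurd h (betaNumber_lt hlt hi).ne

theorem hookLen_cells (Y : YoungDiagram) (i j : ℕ) :
    hookLen Y.cells (i, j) = (Y.rowLen i - j) + (Y.colLen j - (i + 1)) := by
  have h1 : (Y.cells.filter fun v => v.1 = i ∧ j ≤ v.2) = {i} ×ˢ Ico j (Y.rowLen i) := by
    ext ⟨a, b⟩
    simp only [mem_filter, mem_cells, mem_product, mem_singleton, mem_Ico, mem_iff_lt_rowLen]
    constructor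
    · rintro ⟨h, rfl, h'⟩; exact ⟨rfl, h', h⟩
    · rintro ⟨rfl, h', h⟩; exact ⟨h, rfl, h'⟩
  have h2 : (Y.cells.filter fun v => v.2 = j ∧ i < v.1) = Ico (i + 1) (Y.colLen j) ×ˢ {j} := by
    ext ⟨a, b⟩
    simp only [mem_filter, mem_cells, mem_product, mem_singleton, mem_Ico, mem_iff_lt_colLen]
    constructor
    · rintro ⟨h, rfl, h'⟩; exact ⟨⟨h', h⟩, rfl⟩
    · rintro ⟨⟨h', h⟩, rfl⟩; exact ⟨h, rfl, h'⟩
  simp only [hookLen]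
  rw [h1, h2]
  simp

theorem mem_cells_iff_mem_range {Y : YoungDiagram} {n : ℕ} (hn : Y.colLen 0 ≤ n) (p : ℕ × ℕ) :
    p ∈ Y.cells ↔ p.1 ∈ range n ∧ p.2 ∈ range (Y.rowLen p.1) := by
  obtain ⟨i, j⟩ := p
  simp only [mem_cells, mem_range, mem_iff_lt_rowLen]
  refine ⟨fun h => ⟨?_, h⟩, And.right⟩
  by_contra! hi
  rw [rowLen_eq_zero hn hi] at h
  omega

theorem prod_hookLen_row_mul {Y : YoungDiagram} {n i : ℕ} (hn : Y.colLen 0 ≤ n) (hi : i < n) :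
    (∏ j ∈ range (Y.rowLen i), hookLen Y.cells (i, j)) *
      ∏ k ∈ Ioo i n, (Y.betaNumber n i - Y.betaNumber n k) = (Y.betaNumber n i).factorial := by
  have hmem : ∀ a b, b < Y.rowLen a ↔ a < Y.colLen b := fun a b =>
    mem_iff_lt_rowLen.symm.trans mem_iff_lt_colLen
  set f : ℕ → ℕ := fun j => hookLen Y.cells (i, j)
  set g : ℕ → ℕ := fun k => Y.betaNumber n i - Y.betaNumber n k with hg
  have hf' : ∀ j, f j = (Y.rowLen i - j) + (Y.colLen j - (i + 1)) := Y.hookLen_cells i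
  have hfinj : Set.InjOn f (range (Y.rowLen i)) := by
    intro a ha b hb hab
    simp only [coe_range, Set.mem_Iio] at ha hb
    rw [hf', hf'] at hab
    rcases le_total a b with h | h
    · have := Y.colLen_anti a b h
      omega
    · have := Y.colLen_anti b a h
      omega
  have hginj : Set.InjOn g (Ioo i n) := by
    intro a ha b hb hab
    simp only [coe_Ioo, Set.mem_Ioo] at ha hb
    have h1 := betaNumber_lt (Y := Y) ha.1 ha.2
    have h2 := betaNumber_lt (Y := Y) hb.1 hb.2
    simp only [hg] at hab
    exact Y.injOn_betaNumber n (by simp [ha.2]) (by simp [hb.2]) (by omega)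
  have hdisj : Disjoint ((range (Y.rowLen i)).image f) ((Ioo i n).image g) := by
    rw [disjoint_left]
    intro x hx hx'
    obtain ⟨j, hj, rfl⟩ := mem_image.1 hx
    obtain ⟨k, hk, hkj⟩ := mem_image.1 hx'
    rw [mem_range] at hj
    rw [mem_Ioo] at hk
    rw [hf'] at hkj
    have h1 := Y.rowLen_anti i k hk.1.le
    have h2 := hmem k j
    have h3 := (hmem i j).1 hj
    simp only [hg, betaNumber] at hkj
    omega
  have hunion : (range (Y.rowLen i)).image f ∪ (Ioo i n).image g =
      Icc 1 (Y.betaNumber n i) := by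
    refine eq_of_subset_of_card_le ?_ ?_
    · intro x hx
      rcases mem_union.1 hx with h | h
      · obtain ⟨j, hj, rfl⟩ := mem_image.1 h
        rw [mem_range] at hj
        have := Y.colLen_anti 0 j (Nat.zero_le j)
        rw [mem_Icc, hf', betaNumber]
        omega
      · obtain ⟨k, hk, rfl⟩ := mem_image.1 h
        rw [mem_Ioo] at hk
        have := betaNumber_lt (Y := Y) hk.1 hk.2
        simp only [mem_Icc, hg]
        omega
    · rw [card_union_of_disjoint hdisj, card_image_of_injOn hfinj, card_image_of_injOn hginj]
      simp only [Nat.card_Icc, card_range, Nat.card_Ioo, betaNumber]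
      omega
  rw [← Finset.prod_Ico_id_eq_factorial, Ico_add_one_right_eq_Icc, ← hunion,
    prod_union hdisj, prod_image hfinj,
    prod_image hginj]

theorem one_div_hookProd_cells {Y : YoungDiagram} {n : ℕ} (hn : Y.colLen 0 ≤ n) :
    1 / (hookProd Y.cells : ℚ) = frobeniusQuotient n (Y.betaNumber n) := by
  have hprod : hookProd Y.cells * ∏ i ∈ range n, ∏ k ∈ Ioo i n,
      (Y.betaNumber n i - Y.betaNumber n k) = ∏ i ∈ range n, (Y.betaNumber n i).factorial := by
    rw [hookProd, prod_finset_product Y.cells (range n) (fun i => range (Y.rowLen i))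
      (mem_cells_iff_mem_range hn), ← prod_mul_distrib]
    exact prod_congr rfl fun i hi => prod_hookLen_row_mul hn (mem_range.1 hi)
  have hV : orderedVandermonde n (fun i => (Y.betaNumber n i : ℚ)) =
      ((∏ i ∈ range n, ∏ k ∈ Ioo i n, (Y.betaNumber n i - Y.betaNumber n k) : ℕ) : ℚ) := by
    rw [orderedVandermonde]
    push_cast
    refine prod_congr rfl fun i _ => ?_
    rw [← prod_filter]
    have : (range n).filter (fun k => i < k) = Ioo i n := by
      ext k
      simp [and_comm]
    rw [this]
    refine prod_congr rfl fun k hk => ?_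
    rw [mem_Ioo] at hk
    rw [Nat.cast_sub (betaNumber_lt hk.1 hk.2).le]
  have hF : (∏ i ∈ range n, (Y.betaNumber n i).factorial) ≠ 0 :=
    prod_ne_zero_iff.2 fun i _ => Nat.factorial_ne_zero _
  have hH : hookProd Y.cells ≠ 0 := fun h => hF (by rw [← hprod, h, zero_mul])
  have hF' : (∏ i ∈ range n, ((Y.betaNumber n i).factorial : ℚ)) ≠ 0 := by exact_mod_cast hF
  have hH' : (hookProd Y.cells : ℚ) ≠ 0 := by exact_mod_cast hH
  rw [frobeniusQuotient, hV, div_eq_div_iff hH' hF', one_mul, mul_comm]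
  exact_mod_cast hprod.symm

theorem one_div_hookProd_erase_horizontal {Y : YoungDiagram} {n i : ℕ} (hn : Y.colLen 0 ≤ n)
    (h : Y.rowLen (i + 1) + 2 ≤ Y.rowLen i) :
    (1 : ℚ) / hookProd ((Y.cells.erase (i, Y.rowLen i - 2)).erase (i, Y.rowLen i - 2 + 1)) =
      frobeniusQuotient n (Function.update (Y.betaNumber n) i (Y.betaNumber n i - 2)) := by
  have hmem : ∀ a b, (a, b) ∈ (Y.cells.erase (i, Y.rowLen i - 2)).erase (i, Y.rowLen i - 2 + 1) ↔
      b < Y.rowLen a ∧ (a = i → b < Y.rowLen i - 2) := by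
    intro a b
    simp only [mem_erase, ne_eq, Prod.mk.injEq, mem_cells, mem_iff_lt_rowLen]
    by_cases ha : a = i
    · subst ha
      simp only [true_and, true_imp_iff]
      omega
    · simp [ha]
  let Z : YoungDiagram :=
    { cells := (Y.cells.erase (i, Y.rowLen i - 2)).erase (i, Y.rowLen i - 2 + 1)
      isLowerSet := by
        rintro ⟨a, b⟩ ⟨c, d⟩ ⟨hca, hdb⟩ hab
        rw [mem_coe, hmem] at hab ⊢
        simp only at hca hdb
        have h1 := Y.rowLen_anti c a hca
        refine ⟨by omega, ?_⟩
        rintro rfl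
        rcases hca.eq_or_lt with rfl | hlt
        · have := hab.2 rfl
          omega
        · have := Y.rowLen_anti (c + 1) a hlt
          omega }
  have hZ : ∀ a b, (a, b) ∈ Z ↔ b < Y.rowLen a ∧ (a = i → b < Y.rowLen i - 2) := hmem
  have hrow : ∀ a, Z.rowLen a = if a = i then Y.rowLen i - 2 else Y.rowLen a := by
    intro a
    refine rowLen_eq_of_forall fun b => ?_
    rw [hZ]
    split_ifs with ha
    · subst ha
      simp only [true_imp_iff]
      omega
    · simp [ha]
  have hZn : Z.colLen 0 ≤ n := colLen_zero_le <| by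
    have := rowLen_eq_zero hn le_rfl
    rw [hrow]
    split_ifs with ha
    · subst ha
      omega
    · exact this
  have hbeta : Z.betaNumber n = Function.update (Y.betaNumber n) i (Y.betaNumber n i - 2) := by
    funext a
    rw [betaNumber, hrow, Function.update_apply]
    simp only [betaNumber]
    split_ifs with ha
    · subst ha
      omega
    · rfl
  rw [← hbeta, ← one_div_hookProd_cells hZn]

theorem one_div_hookProd_erase_vertical {Y : YoungDiagram} {n i : ℕ} (hn : Y.colLen 0 ≤ n)
    (h : Y.rowLen (i + 1) = Y.rowLen i) (h' : Y.rowLen (i + 2) < Y.rowLen i) :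
    (1 : ℚ) / hookProd ((Y.cells.erase (i, Y.rowLen i - 1)).erase (i + 1, Y.rowLen i - 1)) =
      -frobeniusQuotient n (Function.update (Y.betaNumber n) i (Y.betaNumber n i - 2)) := by
  have hin : i + 1 < n := by
    by_contra! hi
    have := rowLen_eq_zero hn hi
    omega
  have hmem : ∀ a b, (a, b) ∈ (Y.cells.erase (i, Y.rowLen i - 1)).erase (i + 1, Y.rowLen i - 1) ↔
      b < Y.rowLen a ∧ (a = i ∨ a = i + 1 → b < Y.rowLen i - 1) := by
    intro a b
    simp only [mem_erase, ne_eq, Prod.mk.injEq, mem_cells, mem_iff_lt_rowLen]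
    rcases eq_or_ne a i with rfl | ha
    · simp
      omega
    · rcases eq_or_ne a (i + 1) with rfl | ha'
      · simp
        omega
      · simp [ha, ha']
  let Z : YoungDiagram :=
    { cells := (Y.cells.erase (i, Y.rowLen i - 1)).erase (i + 1, Y.rowLen i - 1)
      isLowerSet := by
        rintro ⟨a, b⟩ ⟨c, d⟩ ⟨hca, hdb⟩ hab
        rw [mem_coe, hmem] at hab ⊢
        simp only at hca hdb
        have h1 := Y.rowLen_anti c a hca
        refine ⟨by omega, fun hc => ?_⟩
        by_cases ha : a = i ∨ a = i + 1
        · have := hab.2 ha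
          omega
        · have := Y.rowLen_anti (i + 2) a (by omega)
          omega }
  have hZ : ∀ a b, (a, b) ∈ Z ↔
      b < Y.rowLen a ∧ (a = i ∨ a = i + 1 → b < Y.rowLen i - 1) := hmem
  have hrow : ∀ a, Z.rowLen a = if a = i ∨ a = i + 1 then Y.rowLen i - 1 else Y.rowLen a := by
    intro a
    refine rowLen_eq_of_forall fun b => ?_
    rw [hZ]
    split_ifs with ha
    · simp only [ha, true_imp_iff]
      rcases ha with rfl | rfl <;> omega
    · simp [ha]
  have hZn : Z.colLen 0 ≤ n := colLen_zero_le <| by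
    rw [hrow, if_neg (by omega)]
    exact rowLen_eq_zero hn le_rfl
  have hbeta : Z.betaNumber n =
      Function.update (Y.betaNumber n) i (Y.betaNumber n i - 2) ∘ Equiv.swap i (i + 1) := by
    funext a
    rw [betaNumber, hrow, Function.comp_apply]
    rcases eq_or_ne a i with rfl | ha
    · rw [Equiv.swap_apply_left, Function.update_of_ne (by omega)]
      simp only [betaNumber, true_or, if_true]
      omega
    · rcases eq_or_ne a (i + 1) with rfl | ha'
      · rw [Equiv.swap_apply_right, Function.update_self]
        simp only [betaNumber, or_true, if_true]
        omega
      · rw [Equiv.swap_apply_of_ne_of_ne ha ha', Function.update_of_ne ha,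
          if_neg (by simp [ha, ha'])]
        rfl
  rw [← frobeniusQuotient_comp_swap (by omega : i < n) hin (by omega), ← hbeta,
    ← one_div_hookProd_cells hZn]

/-- The contribution of row `i` to the signed domino sum, in terms of beta numbers. -/
theorem domino_row_eq {Y : YoungDiagram} {n i : ℕ} (hn : Y.colLen 0 ≤ n) (hi : i < n) :
    ((if Y.rowLen (i + 1) + 2 ≤ Y.rowLen i then (1 : ℚ) /
        hookProd ((Y.cells.erase (i, Y.rowLen i - 2)).erase (i, Y.rowLen i - 2 + 1)) else 0) -
      if Y.rowLen (i + 1) = Y.rowLen i ∧ Y.rowLen (i + 2) < Y.rowLen i then (1 : ℚ) /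
        hookProd ((Y.cells.erase (i, Y.rowLen i - 1)).erase (i + 1, Y.rowLen i - 1)) else 0) =
    frobeniusQuotient n (Y.betaNumber n) * ((Y.betaNumber n i : ℚ) * (Y.betaNumber n i - 1) *
      ∏ k ∈ (range n).erase i, ((Y.betaNumber n i : ℚ) - Y.betaNumber n k - 2) /
        (Y.betaNumber n i - Y.betaNumber n k)) := by
  have hinj := Y.injOn_betaNumber n
  have hzero : ∀ k < n, k ≠ i → Y.betaNumber n i = Y.betaNumber n k + 2 →
      ∏ k ∈ (range n).erase i, ((Y.betaNumber n i : ℚ) - Y.betaNumber n k - 2) /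
        (Y.betaNumber n i - Y.betaNumber n k) = 0 := by
    intro k hk hki hb
    refine prod_eq_zero (i := k) (by simp [hk, hki]) ?_
    rw [hb]
    simp
  by_cases hh : Y.rowLen (i + 1) + 2 ≤ Y.rowLen i
  · rw [if_pos hh, if_neg (by omega), sub_zero, one_div_hookProd_erase_horizontal hn hh,
      frobeniusQuotient_update_sub_two hi hinj (by unfold betaNumber; omega)]
  rw [if_neg hh, zero_sub]
  by_cases hv : Y.rowLen (i + 1) = Y.rowLen i ∧ Y.rowLen (i + 2) < Y.rowLen i
  · have hin : i + 1 < n := by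
      by_contra! hi
      have := rowLen_eq_zero hn hi
      omega
    rw [if_pos hv, one_div_hookProd_erase_vertical hn hv.1 hv.2, neg_neg,
      frobeniusQuotient_update_sub_two hi hinj (by unfold betaNumber; omega)]
  rw [if_neg hv, neg_zero]
  have h1 := Y.rowLen_anti i (i + 1) (by omega)
  have h2 := Y.rowLen_anti (i + 1) (i + 2) (by omega)
  by_cases hb : Y.betaNumber n i < 2
  · have : Y.betaNumber n i = 0 ∨ Y.betaNumber n i = 1 := by omega
    rcases this with h | h <;> simp [h]
  by_cases hs : Y.rowLen (i + 1) = Y.rowLen i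
  · have hi2 : i + 2 < n := by
      by_contra! hi2
      have := rowLen_eq_zero hn hi2
      unfold betaNumber at hb
      omega
    rw [hzero (i + 2) hi2 (by omega) (by unfold betaNumber; omega), mul_zero, mul_zero]
  · have hi1 : i + 1 < n := by
      by_contra! hi1
      have := rowLen_eq_zero hn hi1
      unfold betaNumber at hb
      omega
    rw [hzero (i + 1) hi1 (by omega) (by unfold betaNumber; omega), mul_zero, mul_zero]

theorem sum_horizontal_domino {Y : YoungDiagram} {n : ℕ} (hn : Y.colLen 0 ≤ n)
    (f : ℕ × ℕ → ℚ) :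
    (∑ u ∈ Y.cells.filter fun u => (u.1, u.2 + 1) ∈ Y.cells ∧ (u.1 + 1, u.2) ∉ Y.cells ∧
        (u.1 + 1, u.2 + 1) ∉ Y.cells ∧ (u.1, u.2 + 2) ∉ Y.cells, f u) =
      ∑ i ∈ range n, if Y.rowLen (i + 1) + 2 ≤ Y.rowLen i then f (i, Y.rowLen i - 2) else 0 := by
  rw [sum_filter, sum_finset_product Y.cells (range n) (fun i => range (Y.rowLen i))
    (mem_cells_iff_mem_range hn)]
  refine sum_congr rfl fun i _ => ?_
  simp only [mem_cells, mem_iff_lt_rowLen]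
  rw [sum_eq_single (Y.rowLen i - 2)]
  · exact if_congr (by omega) rfl rfl
  · intro j hj hne
    rw [mem_range] at hj
    exact if_neg (by omega)
  · intro hj
    rw [mem_range] at hj
    exact if_neg (by omega)

theorem sum_vertical_domino {Y : YoungDiagram} {n : ℕ} (hn : Y.colLen 0 ≤ n)
    (f : ℕ × ℕ → ℚ) :
    (∑ u ∈ Y.cells.filter fun u => (u.1 + 1, u.2) ∈ Y.cells ∧ (u.1, u.2 + 1) ∉ Y.cells ∧
        (u.1 + 1, u.2 + 1) ∉ Y.cells ∧ (u.1 + 2, u.2) ∉ Y.cells, f u) =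
      ∑ i ∈ range n, if Y.rowLen (i + 1) = Y.rowLen i ∧ Y.rowLen (i + 2) < Y.rowLen i then
        f (i, Y.rowLen i - 1) else 0 := by
  rw [sum_filter, sum_finset_product Y.cells (range n) (fun i => range (Y.rowLen i))
    (mem_cells_iff_mem_range hn)]
  refine sum_congr rfl fun i _ => ?_
  simp only [mem_cells, mem_iff_lt_rowLen]
  have h1 := Y.rowLen_anti i (i + 1) (by omega)
  have h2 := Y.rowLen_anti (i + 1) (i + 2) (by omega)
  rw [sum_eq_single (Y.rowLen i - 1)]
  · exact if_congr (by omega) rfl rfl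
  · intro j hj hne
    rw [mem_range] at hj
    exact if_neg (by omega)
  · intro hj
    rw [mem_range] at hj
    exact if_neg (by omega)

theorem two_mul_content_sum {Y : YoungDiagram} {n : ℕ} (hn : Y.colLen 0 ≤ n) :
    2 * ∑ u ∈ Y.cells, ((u.2 : ℚ) - (u.1 : ℚ)) =
      ∑ i ∈ range n, ((Y.rowLen i : ℚ) * (Y.rowLen i - 1) - 2 * i * Y.rowLen i) := by
  rw [sum_finset_product Y.cells (range n) (fun i => range (Y.rowLen i))
    (mem_cells_iff_mem_range hn), mul_sum]
  refine sum_congr rfl fun i _ => ?_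
  simp only
  induction Y.rowLen i with
  | zero => simp
  | succ m ih =>
    rw [sum_range_succ, mul_add, ih]
    push_cast
    ring

theorem sum_range_shift_mul (n : ℕ) :
    ∑ i ∈ range n, ((n : ℚ) - 1 - i) * (n + i) = 2 * ∑ k ∈ range n, (k : ℚ) ^ 2 := by
  have h1 : ∀ n : ℕ, 2 * ∑ k ∈ range n, (k : ℚ) = n * (n - 1) := fun n => by
    induction n with
    | zero => simp
    | succ m ih => rw [sum_range_succ, mul_add, ih]; push_cast; ring
  have h2 : ∀ n : ℕ, 6 * ∑ k ∈ range n, (k : ℚ) ^ 2 = n * (n - 1) * (2 * n - 1) := fun n => by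
    induction n with
    | zero => simp
    | succ m ih => rw [sum_range_succ, mul_add, ih]; push_cast; ring
  have h3 : ∑ i ∈ range n, ((n : ℚ) - 1 - i) * (n + i) =
      n * ((n - 1) * n) - ∑ k ∈ range n, (k : ℚ) - ∑ k ∈ range n, (k : ℚ) ^ 2 := by
    have : (n : ℚ) * ((n - 1) * n) = ∑ _k ∈ range n, ((n : ℚ) - 1) * n := by simp
    rw [this, ← sum_sub_distrib, ← sum_sub_distrib]
    exact sum_congr rfl fun k _ => by ring
  rw [h3]
  linear_combination (-1 / 2) * h1 n - (1 / 2) * h2 n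

theorem sum_betaNumber_mul_prod {Y : YoungDiagram} {n : ℕ} (hn : Y.colLen 0 ≤ n) :
    ∑ i ∈ range n, ((Y.betaNumber n i : ℚ) * (Y.betaNumber n i - 1) *
      ∏ k ∈ (range n).erase i, ((Y.betaNumber n i : ℚ) - Y.betaNumber n k - 2) /
        (Y.betaNumber n i - Y.betaNumber n k)) =
      2 * ∑ u ∈ Y.cells, ((u.2 : ℚ) - (u.1 : ℚ)) := by
  have hinj : Set.InjOn (fun i => (Y.betaNumber n i : ℚ)) (range n) :=
    fun a ha b hb h => Y.injOn_betaNumber n ha hb (Nat.cast_injective h)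
  have hres := residueSum_mul_sub_one hinj
  rw [card_range] at hres
  have hS : residueSum (range n) (fun i => (Y.betaNumber n i : ℚ)) (fun t => t * (t - 1)) =
      -2 * ∑ i ∈ range n, ((Y.betaNumber n i : ℚ) * (Y.betaNumber n i - 1) *
      ∏ k ∈ (range n).erase i, ((Y.betaNumber n i : ℚ) - Y.betaNumber n k - 2) /
        (Y.betaNumber n i - Y.betaNumber n k)) := by
    rw [residueSum, mul_sum]
    exact sum_congr rfl fun i _ => by ring
  have hcont : ∑ i ∈ range n, ((Y.rowLen i : ℚ) * (Y.rowLen i - 1) - 2 * i * Y.rowLen i) =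
      ∑ i ∈ range n, (Y.betaNumber n i : ℚ) * (Y.betaNumber n i - 1) -
        2 * (n - 1) * ∑ i ∈ range n, (Y.betaNumber n i : ℚ) +
        ∑ i ∈ range n, ((n : ℚ) - 1 - i) * (n + i) := by
    rw [mul_sum, ← sum_sub_distrib, ← sum_add_distrib]
    refine sum_congr rfl fun i hi => ?_
    have hb : (Y.betaNumber n i : ℚ) = Y.rowLen i + (n - 1 - i) := by
      obtain ⟨d, rfl⟩ := Nat.exists_eq_add_of_lt (mem_range.1 hi)
      rw [betaNumber, show i + d + 1 - 1 - i = d by omega]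
      push_cast
      ring
    rw [hb]
    ring
  rw [two_mul_content_sum hn, hcont, sum_range_shift_mul]
  linear_combination (-1 / 2) * (hres - hS)

end YoungDiagram

end

/-- For a Young diagram `Y`, twice the sum of contents divided by `H_Y` equals the sum
over removable horizontal dominoes of `1/H_{Y-hd}` minus the sum over removable vertical
dominoes of `1/H_{Y-vd}`. A removable horizontal (resp. vertical) domino is identified
by its leftmost (resp. topmost) box. -/
theorem two_content_sum_div_hookProd_eq_domino_sums (Y : YoungDiagram) :
    2 * (∑ u ∈ Y.cells, ((u.2 : ℚ) - (u.1 : ℚ))) / hookProd Y.cells =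
    (∑ u ∈ Y.cells.filter fun u => (u.1, u.2 + 1) ∈ Y.cells ∧ (u.1 + 1, u.2) ∉ Y.cells ∧
        (u.1 + 1, u.2 + 1) ∉ Y.cells ∧ (u.1, u.2 + 2) ∉ Y.cells,
      (1 : ℚ) / hookProd ((Y.cells.erase u).erase (u.1, u.2 + 1))) -
    (∑ u ∈ Y.cells.filter fun u => (u.1 + 1, u.2) ∈ Y.cells ∧ (u.1, u.2 + 1) ∉ Y.cells ∧
        (u.1 + 1, u.2 + 1) ∉ Y.cells ∧ (u.1 + 2, u.2) ∉ Y.cells,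
      (1 : ℚ) / hookProd ((Y.cells.erase u).erase (u.1 + 1, u.2))) := by
  have hn : Y.colLen 0 ≤ Y.colLen 0 := le_rfl
  rw [YoungDiagram.sum_horizontal_domino hn, YoungDiagram.sum_vertical_domino hn,
    ← Finset.sum_sub_distrib, Finset.sum_congr rfl fun i hi =>
      YoungDiagram.domino_row_eq hn (Finset.mem_range.1 hi),
    ← Finset.mul_sum, YoungDiagram.sum_betaNumber_mul_prod hn,
    ← YoungDiagram.one_div_hookProd_cells hn, one_div_mul_eq_div]
end

section
/- Let a_1 < ... < a_n be positive integers with a_i ≤ 2i - 1. Then the sum over k = 1,...,n of the determinant of the n×n matrix with entries 1/(a_i - j)! except that in row k the entry is (a_i - j)(a_i - j - 1)/(a_i - j)!, equals (sum over k of (a_k - k)(a_k - 2n + k - 1)) times the determinant of the matrix with entries 1/(a_i - j)!. Here 1/m! = 0 for m < 0. -/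
namespace Matrix

theorem sum_det_updateRow {n R : Type*} [Fintype n] [DecidableEq n] [CommRing R]
    (A B : Matrix n n R) : ∑ k, (A.updateRow k (B k)).det = (A.adjugate * B).trace := by
  rw [trace_mul_comm]
  refine Finset.sum_congr rfl fun k _ => ?_
  rw [← cramer_transpose_apply, cramer_eq_adjugate_mulVec, ← adjugate_transpose]
  simp [mulVec, dotProduct, diag, mul_apply, mul_comm]

theorem sum_det_updateRow_mul_add_mul {n R : Type*} [Fintype n] [DecidableEq n] [CommRing R]
    (A D N : Matrix n n R) :
    ∑ k, (A.updateRow k ((D * A + A * N) k)).det = (D.trace + N.trace) * A.det := by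
  rw [sum_det_updateRow, mul_add, trace_add, ← mul_assoc, ← mul_assoc, trace_mul_comm,
    ← mul_assoc, mul_adjugate, adjugate_mul]
  simp
  ring

end Matrix

/-- The reciprocal factorial `1 / (a - (j + 1))!`, which is `0` when `a < j + 1`. -/
def invFactorialSub (a j : ℕ) : ℚ :=
  if j + 1 ≤ a then 1 / ((a - (j + 1)).factorial : ℚ) else 0

theorem invFactorialSub_succ (a j : ℕ) :
    invFactorialSub a (j + 1) = ((a : ℚ) - (j + 1)) * invFactorialSub a j := by
  unfold invFactorialSub
  by_cases h : j + 1 ≤ a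
  · obtain ⟨m, rfl⟩ := Nat.exists_eq_add_of_le h
    cases m with
    | zero => simp
    | succ m =>
      have h₁ : j + 1 + (m + 1) - (j + 1) = m + 1 := by omega
      have h₂ : j + 1 + (m + 1) - (j + 1 + 1) = m := by omega
      rw [if_pos (by omega), if_pos (by omega), h₁, h₂, Nat.factorial_succ]
      have := Nat.factorial_ne_zero m
      push_cast
      field_simp
      ring
  · rw [if_neg (by omega), if_neg h, mul_zero]

theorem ite_natCast_mul_sub_one_div_factorial (a j : ℕ) :
    (if j + 1 ≤ a then
      (((a - (j + 1)) * (a - (j + 1) - 1) : ℕ) : ℚ) / ((a - (j + 1)).factorial : ℚ) else 0) =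
      ((a : ℚ) - (j + 1)) * ((a : ℚ) - (j + 1) - 1) * invFactorialSub a j := by
  unfold invFactorialSub
  split_ifs with h
  · obtain ⟨m, rfl⟩ := Nat.exists_eq_add_of_le h
    rw [Nat.add_sub_cancel_left]
    cases m with
    | zero => simp
    | succ m =>
      rw [Nat.add_sub_cancel]
      push_cast
      ring
  · rw [mul_zero]

/-- The lower bidiagonal matrix recording how the row modification acts on columns. -/
def bidiagonalCorrection (n : ℕ) : Matrix (Fin n) (Fin n) ℚ := Matrix.of fun l j =>
  (if l = j then (j : ℚ) * (2 * n - 1 - j) else 0) +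
    (if (l : ℕ) = j + 1 then 2 * ((n : ℚ) - 1 - j) else 0)

theorem trace_bidiagonalCorrection (n : ℕ) :
    (bidiagonalCorrection n).trace = ∑ j : Fin n, (j : ℚ) * (2 * n - 1 - j) := by
  simp [Matrix.trace, bidiagonalCorrection]

theorem sum_mul_bidiagonalCorrection (n : ℕ) (f : ℕ → ℚ) (j : Fin n) :
    ∑ l : Fin n, f l * bidiagonalCorrection n l j =
      f j * ((j : ℚ) * (2 * n - 1 - j)) + f (j + 1) * (2 * ((n : ℚ) - 1 - j)) := by
  simp only [bidiagonalCorrection, Matrix.of_apply, mul_add, Finset.sum_add_distrib, mul_ite,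
    mul_zero, Finset.sum_ite_eq', Finset.mem_univ, if_true]
  congr 1
  by_cases h : (j : ℕ) + 1 < n
  · rw [Finset.sum_eq_single ⟨j + 1, h⟩]
    · simp
    · intro l _ hl
      exact if_neg fun h' => hl (Fin.ext h')
    · simp
  · have hn : (n : ℚ) = j + 1 := by exact_mod_cast (show n = j + 1 by omega)
    rw [hn, Finset.sum_eq_zero]
    · ring
    · intro l _
      exact if_neg (by omega)


/-- For `a₁ < ⋯ < aₙ` positive with `aᵢ ≤ 2i - 1`: the sum over `k` of the determinant
of the matrix with entries `1/(aᵢ-j)!` except row `k`, where the entry is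
`(aᵢ-j)(aᵢ-j-1)/(aᵢ-j)!`, equals `(∑ₖ (aₖ-k)(aₖ-2n+k-1))·det(1/(aᵢ-j)!)`.
Here `1/m! = 0` for `m < 0`. -/
theorem sum_det_row_modified_eq (n : ℕ) (a : Fin n → ℕ) (ha : StrictMono a)
    (h1 : ∀ i, 1 ≤ a i) (h2 : ∀ i : Fin n, a i ≤ 2 * (i : ℕ) + 1) :
    ∑ k : Fin n, Matrix.det (Matrix.of fun i j : Fin n =>
        if (j : ℕ) + 1 ≤ a i then
          (if i = k then ((a i - ((j : ℕ) + 1)) * (a i - ((j : ℕ) + 1) - 1) : ℕ) else 1)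
            / ((a i - ((j : ℕ) + 1)).factorial : ℚ)
        else 0) =
    (∑ k : Fin n, ((a k : ℚ) - ((k : ℕ) + 1)) *
        ((a k : ℚ) - 2 * n + ((k : ℕ) + 1) - 1)) *
      Matrix.det (Matrix.of fun i j : Fin n =>
        if (j : ℕ) + 1 ≤ a i then (1 : ℚ) / ((a i - ((j : ℕ) + 1)).factorial) else 0) := by
  set A : Matrix (Fin n) (Fin n) ℚ := Matrix.of fun i j => invFactorialSub (a i) j with hA
  set D : Matrix (Fin n) (Fin n) ℚ := Matrix.diagonal fun i =>
    ((a i : ℚ) - 1) ^ 2 - (2 * n - 1) * ((a i : ℚ) - 1) with hD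
  have hrow : ∀ k j, (D * A + A * bidiagonalCorrection n) k j =
      ((a k : ℚ) - ((j : ℕ) + 1)) * ((a k : ℚ) - ((j : ℕ) + 1) - 1) *
        invFactorialSub (a k) j := by
    intro k j
    rw [Matrix.add_apply, hD, Matrix.diagonal_mul, Matrix.mul_apply]
    simp only [hA, Matrix.of_apply]
    rw [sum_mul_bidiagonalCorrection n (invFactorialSub (a k)), invFactorialSub_succ]
    ring
  have htrace : ∑ k : Fin n, ((a k : ℚ) - ((k : ℕ) + 1)) *
      ((a k : ℚ) - 2 * n + ((k : ℕ) + 1) - 1) = D.trace + (bidiagonalCorrection n).trace := by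
    rw [trace_bidiagonalCorrection, hD, Matrix.trace_diagonal, ← Finset.sum_add_distrib]
    refine Finset.sum_congr rfl fun k _ => ?_
    ring
  rw [htrace]
  refine Eq.trans (Finset.sum_congr rfl fun k _ => congrArg Matrix.det ?_)
    (Matrix.sum_det_updateRow_mul_add_mul A D (bidiagonalCorrection n))
  ext i j
  rw [Matrix.updateRow_apply]
  by_cases hik : i = k
  · subst hik
    rw [if_pos rfl, hrow, ← ite_natCast_mul_sub_one_div_factorial]
    simp
  · simp [hik, hA, invFactorialSub]
end
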